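/- For every integer n ≥ 5, the energy of the spherical solution v_sph(t) = (cosh t)^((4−n)/2) vanishes identically: H(v_sph)(t) = 0 for every t ∈ ℝ. -/

import Mathlib

lemma hasDerivAt_tanh_aux (t : ℝ) :
    HasDerivAt (fun x => Real.sinh x / Real.cosh x) (1 - (Real.sinh t / Real.cosh t) ^ 2) t := by
  have hc := (Real.cosh_pos t).ne'
  refine ((Real.hasDerivAt_sinh t).div (Real.hasDerivAt_cosh t) hc).congr_deriv ?_
  field_simp

lemma hasDerivAt_v_aux (a t : ℝ) :
    HasDerivAt (fun x => Real.cosh x ^ a)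
      (Real.cosh t ^ a * (a * (Real.sinh t / Real.cosh t))) t := by
  have hc := (Real.cosh_pos t).ne'
  refine ((Real.hasDerivAt_cosh t).rpow_const (Or.inl hc)).congr_deriv ?_
  rw [Real.rpow_sub_one hc]
  field_simp

/-- For every integer `n ≥ 5`, the energy of the spherical solution
`v_sph t = (cosh t)^((4-n)/2)` vanishes identically. -/
theorem stmt_8 (n : ℕ) (hn : 5 ≤ n) :
    let v : ℝ → ℝ := fun t => Real.cosh t ^ ((4 - (n : ℝ)) / 2)
    let H : ℝ → ℝ := fun t =>
      -(deriv v t) * iteratedDeriv 3 v t + (1 / 2) * (iteratedDeriv 2 v t) ^ 2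
        + (((n : ℝ) * ((n : ℝ) - 4) + 8) / 4) * (deriv v t) ^ 2
        - ((n : ℝ) ^ 2 * ((n : ℝ) - 4) ^ 2 / 32) * (v t) ^ 2
        + (((n : ℝ) - 4) ^ 2 * ((n : ℝ) ^ 2 - 4) / 32)
            * v t ^ (2 * (n : ℝ) / ((n : ℝ) - 4))
    ∀ t : ℝ, H t = 0 := by
  intro v H t
  set a : ℝ := (4 - (n : ℝ)) / 2 with ha
  have hn4 : (n : ℝ) - 4 ≠ 0 := by
    have : (5 : ℝ) ≤ n := by exact_mod_cast hn
    intro h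
    linarith
  have hna : (n : ℝ) = 4 - 2 * a := by rw [ha]; ring
  let T : ℝ → ℝ := fun x => Real.sinh x / Real.cosh x
  have hT : ∀ x, HasDerivAt T (1 - T x ^ 2) x := hasDerivAt_tanh_aux
  have hv : ∀ x, HasDerivAt v (v x * (a * T x)) x := hasDerivAt_v_aux a
  have d1 : deriv v = fun x => v x * (a * T x) := funext fun x => (hv x).deriv
  have d2 : iteratedDeriv 2 v = fun x => v x * (a + (a ^ 2 - a) * T x ^ 2) := by
    rw [iteratedDeriv_succ, iteratedDeriv_one, d1]
    funext x
    refine (((hv x).mul ((hT x).const_mul a)).congr_deriv ?_).deriv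
    ring
  have d3 : iteratedDeriv 3 v = fun x =>
      v x * T x * (3 * a ^ 2 - 2 * a + (a ^ 2 - a) * (a - 2) * T x ^ 2) := by
    rw [iteratedDeriv_succ, d2]
    funext x
    refine (((hv x).mul ((((hT x).pow 2).const_mul (a ^ 2 - a)).const_add a)).congr_deriv ?_).deriv
    simp only [Pi.pow_apply]
    push_cast
    ring
  have hc := Real.cosh_pos t
  have hp : v t ^ (2 * (n : ℝ) / ((n : ℝ) - 4)) = v t ^ 2 * (1 - T t ^ 2) ^ 2 := by
    have h1 : 1 - T t ^ 2 = (Real.cosh t ^ 2)⁻¹ := by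
      have := Real.cosh_sq t
      simp only [T]
      field_simp
      linarith
    have h2 : a * (2 * (n : ℝ) / ((n : ℝ) - 4)) = a + a - (4 : ℕ) := by
      rw [ha]
      field_simp
      push_cast
      ring
    rw [h1]
    simp only [v]
    simp only [← ha]
    rw [← Real.rpow_mul hc.le, h2, Real.rpow_sub hc, Real.rpow_add hc, Real.rpow_natCast]
    field_simp
  simp only [H]
  rw [hp, d1, d2, d3, hna]
  ring
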